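/- (Lemma 5.3) Let μ ∈ (0,2) and let Ω₁, Ω₂ ⊂ ℝ² be bounded domains, each satisfying a uniform exterior cone condition, with 0 ∈ ∂Ω₁ ∩ ∂Ω₂, such that Ω₁ ∩ B_ρ = Ω₂ ∩ B_ρ for some ρ > 0, and such that the common boundary near the origin consists of two C² curves meeting at the origin at angle μπ (so that both domains have tangent cone V_μ of opening angle μπ at the origin). Let u₁, u₂ ∈ C^∞ be the solutions of Δu = e^{2u} with u → +∞ at the boundary, in Ω₁ and Ω₂ respectively. Then there exist positive constants C and δ such that |u₁(z) − u₂(z)| ≤ C |z|^{1/μ} for all z ∈ Ω₁ ∩ B_δ. -/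

import Mathlib

/-- The Laplacian of a function on `ℂ ≅ ℝ²`: sum of the second directional
derivatives in the two coordinate directions `1` and `I`. -/
noncomputable def lap (u : ℂ → ℝ) (z : ℂ) : ℝ :=
  fderiv ℝ (fun w => fderiv ℝ u w 1) z 1 +
  fderiv ℝ (fun w => fderiv ℝ u w Complex.I) z Complex.I

/-- The polar angle of a nonzero complex number, normalized to lie in `(0, 2π]`. -/
noncomputable def polarAngle (z : ℂ) : ℝ :=
  if 0 < Complex.arg z then Complex.arg z else Complex.arg z + 2 * Real.pi

/-- The real (Euclidean) inner product on `ℂ ≅ ℝ²`. -/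
def realInner (a b : ℂ) : ℝ := a.re * b.re + a.im * b.im

/-- The closed finite cone with vertex `p`, axis direction `e`, height `h`
and half-opening angle `θ₀`. -/
def finiteCone (p e : ℂ) (h θ₀ : ℝ) : Set ℂ :=
  {z | ∃ (t : ℝ) (ω : ℂ), 0 ≤ t ∧ t ≤ h ∧ ‖ω‖ = 1 ∧
    Real.cos θ₀ ≤ realInner ω e ∧ z = p + t • ω}

/-- `Ω` satisfies the uniform exterior cone condition with height `h` and
half-opening angle `θ₀`. -/
def UnifExtCone (Ω : Set ℂ) (h θ₀ : ℝ) : Prop :=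
  ∀ p ∈ frontier Ω, ∃ e : ℂ, ‖e‖ = 1 ∧ finiteCone p e h θ₀ ∩ Ω = ∅

/-- The open sector `{r e^{iθ} : 0 < r < r₀, a < θ < b}`. -/
def sector (a b r₀ : ℝ) : Set ℂ :=
  {z | ∃ r θ : ℝ, 0 < r ∧ r < r₀ ∧ a < θ ∧ θ < b ∧
    z = (r : ℂ) * Complex.exp ((θ : ℂ) * Complex.I)}

/-- `Ω` has tangent cone `V_μ = {(r,θ) : r > 0, 0 < θ < μπ}` at the origin:
for every `ε > 0` there is `r₀ > 0` with
`{(r,θ) : 0 < r < r₀, ε < θ < μπ − ε} ⊆ Ω ∩ B_{r₀} ⊆ {(r,θ) : 0 < r < r₀, −ε < θ < μπ + ε}`. -/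
def HasTangentCone (Ω : Set ℂ) (μ : ℝ) : Prop :=
  ∀ ε : ℝ, 0 < ε → ∃ r₀ : ℝ, 0 < r₀ ∧
    sector ε (μ * Real.pi - ε) r₀ ⊆ Ω ∩ Metric.ball 0 r₀ ∧
    Ω ∩ Metric.ball 0 r₀ ⊆ sector (-ε) (μ * Real.pi + ε) r₀

/-- `∂Ω` in a neighborhood of the origin consists of two `C²` curves `γ₁, γ₂`, each
parametrized by arc length on `[0, bᵢ]` with an endpoint at the origin, meeting at the
origin at angle `μπ`; coordinates are chosen (after a rotation) so that the tangent ray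
of `γ₁` at the origin is the positive real axis and that of `γ₂` makes angle `μπ` with
it, the tangent cone of `Ω` at the origin being `V_μ`. -/
structure CornerAt (Ω : Set ℂ) (μ : ℝ) (γ₁ γ₂ : ℝ → ℂ) (b₁ b₂ : ℝ) : Prop where
  b₁_pos : 0 < b₁
  b₂_pos : 0 < b₂
  smooth₁ : ContDiff ℝ 2 γ₁
  smooth₂ : ContDiff ℝ 2 γ₂
  start₁ : γ₁ 0 = 0
  start₂ : γ₂ 0 = 0
  inj₁ : Set.InjOn γ₁ (Set.Icc 0 b₁)
  inj₂ : Set.InjOn γ₂ (Set.Icc 0 b₂)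
  unitSpeed₁ : ∀ t ∈ Set.Icc (0 : ℝ) b₁, ‖deriv γ₁ t‖ = 1
  unitSpeed₂ : ∀ t ∈ Set.Icc (0 : ℝ) b₂, ‖deriv γ₂ t‖ = 1
  tangent₁ : deriv γ₁ 0 = 1
  tangent₂ : deriv γ₂ 0 = Complex.exp ((μ * Real.pi : ℝ) * Complex.I)
  boundary : ∃ r : ℝ, 0 < r ∧
    frontier Ω ∩ Metric.ball 0 r
      = (γ₁ '' Set.Icc 0 b₁ ∪ γ₂ '' Set.Icc 0 b₂) ∩ Metric.ball 0 r
  tangentCone : HasTangentCone Ω μ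

open Filter Topology Metric Set
open scoped Laplacian

/-! ### The Laplacian on the plane -/

theorem fderiv_fderiv_apply {u : ℂ → ℝ} {z : ℂ} (hu : ContDiffAt ℝ 2 u z) (v : ℂ) :
    fderiv ℝ (fun w => fderiv ℝ u w v) z v = fderiv ℝ (fderiv ℝ u) z v v := by
  have h : DifferentiableAt ℝ (fderiv ℝ u) z :=
    (hu.fderiv_right (m := 1) (by norm_num)).differentiableAt (by norm_num)
  rw [fderiv_clm_apply h (differentiableAt_const v)]
  simp

theorem lap_eq_laplacian {u : ℂ → ℝ} {z : ℂ} (hu : ContDiffAt ℝ 2 u z) :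
    lap u z = (Δ u) z := by
  rw [InnerProductSpace.laplacian_eq_iteratedFDeriv_complexPlane, lap,
    fderiv_fderiv_apply hu, fderiv_fderiv_apply hu]
  simp [iteratedFDeriv_two_apply]

theorem lap_add {u v : ℂ → ℝ} {z : ℂ} (hu : ContDiffAt ℝ 2 u z) (hv : ContDiffAt ℝ 2 v z) :
    lap (fun w => u w + v w) z = lap u z + lap v z := by
  rw [lap_eq_laplacian hu, lap_eq_laplacian hv, lap_eq_laplacian (hu.add hv)]
  exact hu.laplacian_add hv

theorem lap_sub {u v : ℂ → ℝ} {z : ℂ} (hu : ContDiffAt ℝ 2 u z) (hv : ContDiffAt ℝ 2 v z) :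
    lap (fun w => u w - v w) z = lap u z - lap v z := by
  rw [lap_eq_laplacian hu, lap_eq_laplacian hv, lap_eq_laplacian (hu.sub hv)]
  exact hu.laplacian_sub hv

theorem lap_const (c : ℝ) (z : ℂ) : lap (fun _ => c) z = 0 := by
  simp [lap]

theorem lap_const_mul {u : ℂ → ℝ} {z : ℂ} (c : ℝ) (hu : ContDiffAt ℝ 2 u z) :
    lap (fun w => c * u w) z = c * lap u z := by
  rw [lap_eq_laplacian hu, lap_eq_laplacian (contDiffAt_const.mul hu)]
  exact InnerProductSpace.laplacian_smul c hu

/-- Chain rule for the Laplacian of `φ ∘ P`. -/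
theorem lap_comp {P : ℂ → ℝ} {z : ℂ} {φ φ₁ : ℝ → ℝ} {φ₂ : ℝ} (hP : ContDiffAt ℝ 2 P z)
    (hφ : ∀ᶠ x in 𝓝 (P z), HasDerivAt φ (φ₁ x) x) (hφ₁ : HasDerivAt φ₁ φ₂ (P z)) :
    lap (fun w => φ (P w)) z =
      φ₁ (P z) * lap P z + φ₂ * (fderiv ℝ P z 1 ^ 2 + fderiv ℝ P z Complex.I ^ 2) := by
  have hdir : ∀ v : ℂ, fderiv ℝ (fun w => fderiv ℝ (fun w => φ (P w)) w v) z v =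
      φ₁ (P z) * fderiv ℝ (fun w => fderiv ℝ P w v) z v + φ₂ * fderiv ℝ P z v ^ 2 := by
    intro v
    have hd : ∀ᶠ w in 𝓝 z, DifferentiableAt ℝ P w :=
      (hP.eventually (by simp)).mono fun w hw => hw.differentiableAt (by norm_num)
    have heq : (fun w => fderiv ℝ (fun w => φ (P w)) w v) =ᶠ[𝓝 z]
        fun w => φ₁ (P w) * fderiv ℝ P w v := by
      filter_upwards [hd, hP.continuousAt.eventually hφ] with w hw hφw
      have := (hφw.comp_hasFDerivAt w hw.hasFDerivAt).fderiv
      simp only [Function.comp_def] at this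
      simp [this]
    have hP' : DifferentiableAt ℝ (fun w => fderiv ℝ P w v) z :=
      ((hP.fderiv_right (m := 1) (by norm_num)).differentiableAt (by norm_num)).clm_apply
        (differentiableAt_const v)
    have h1 := hφ₁.comp_hasFDerivAt z (hd.self_of_nhds).hasFDerivAt
    have h2 := (h1.mul hP'.hasFDerivAt).fderiv
    rw [heq.fderiv_eq]
    simp only [Function.comp_def] at h2
    erw [h2]
    simp
    ring
  rw [lap, lap, hdir, hdir]
  ring

theorem hasFDerivAt_normSq_sub (q z : ℂ) :
    HasFDerivAt (fun w : ℂ => ‖w - q‖ ^ 2) (2 • innerSL ℝ (z - q)) z := by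
  have := ((hasFDerivAt_id (𝕜 := ℝ) z).sub_const q).norm_sq
  simpa using this

theorem contDiff_normSq_sub (q : ℂ) : ContDiff ℝ 2 (fun w : ℂ => ‖w - q‖ ^ 2) :=
  (contDiff_id.sub contDiff_const).norm_sq ℝ

theorem fderiv_normSq_sub (q z v : ℂ) :
    fderiv ℝ (fun w : ℂ => ‖w - q‖ ^ 2) z v = 2 * ((z - q).re * v.re + (z - q).im * v.im) := by
  rw [(hasFDerivAt_normSq_sub q z).fderiv]
  simp [Complex.inner]
  ring

theorem lap_normSq_sub (q z : ℂ) : lap (fun w : ℂ => ‖w - q‖ ^ 2) z = 4 := by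
  have h1 : ∀ v : ℂ, fderiv ℝ
      (fun w : ℂ => 2 * ((w - q).re * v.re + (w - q).im * v.im)) z v =
        2 * (v.re ^ 2 + v.im ^ 2) := by
    intro v
    have hre : HasFDerivAt (fun w : ℂ => (w - q).re) Complex.reCLM z :=
      Complex.reCLM.hasFDerivAt.comp z ((hasFDerivAt_id (𝕜 := ℝ) z).sub_const q)
    have him : HasFDerivAt (fun w : ℂ => (w - q).im) Complex.imCLM z :=
      Complex.imCLM.hasFDerivAt.comp z ((hasFDerivAt_id (𝕜 := ℝ) z).sub_const q)
    have h := (((hre.mul_const v.re).add (him.mul_const v.im)).const_mul 2).fderiv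
    refine (congrArg (fun L : ℂ →L[ℝ] ℝ => L v) h).trans ?_
    simp
    ring
  simp only [lap, fderiv_normSq_sub, h1]
  simp
  norm_num

/-- The Laplacian of a radial function, written as a function of the squared radius. -/
theorem lap_radial {φ φ₁ : ℝ → ℝ} {φ₂ : ℝ} {q z : ℂ}
    (hφ : ∀ᶠ x in 𝓝 (‖z - q‖ ^ 2), HasDerivAt φ (φ₁ x) x)
    (hφ₁ : HasDerivAt φ₁ φ₂ (‖z - q‖ ^ 2)) :
    lap (fun w => φ (‖w - q‖ ^ 2)) z =
      4 * φ₁ (‖z - q‖ ^ 2) + 4 * ‖z - q‖ ^ 2 * φ₂ := by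
  rw [lap_comp (contDiff_normSq_sub q).contDiffAt hφ hφ₁, lap_normSq_sub, fderiv_normSq_sub,
    fderiv_normSq_sub, Complex.sq_norm, Complex.normSq_apply]
  simp
  ring

theorem lap_nonpos_of_isLocalMax {F : ℂ → ℝ} {z : ℂ} (hF : ContDiffAt ℝ 2 F z)
    (hmax : IsLocalMax F z) : lap F z ≤ 0 := by
  have key : ∀ v : ℂ, fderiv ℝ (fun w => fderiv ℝ F w v) z v ≤ 0 := by
    intro v
    by_contra! hpos
    have hline : ∀ t : ℝ, HasDerivAt (fun t : ℝ => z + t • v) v t := fun t => by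
      simpa using ((hasDerivAt_id t).smul_const v).const_add z
    have hlim : Tendsto (fun t : ℝ => z + t • v) (𝓝 0) (𝓝 z) := by
      simpa using (hline 0).continuousAt.tendsto
    set g : ℝ → ℝ := fun t => F (z + t • v) with hg
    have hd : ∀ᶠ w in 𝓝 z, DifferentiableAt ℝ F w :=
      (hF.eventually (by simp)).mono fun w hw => hw.differentiableAt (by norm_num)
    have hg1 : deriv g =ᶠ[𝓝 0] fun t => fderiv ℝ F (z + t • v) v := by
      filter_upwards [hlim.eventually hd] with t ht
      exact (ht.hasFDerivAt.comp_hasDerivAt t (hline t)).deriv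
    have hF' : DifferentiableAt ℝ (fun w => fderiv ℝ F w v) (z + (0 : ℝ) • v) := by
      simpa using ((hF.fderiv_right (m := 1) (by norm_num)).differentiableAt
        (by norm_num)).clm_apply (differentiableAt_const v)
    have hg2 : deriv (deriv g) 0 = fderiv ℝ (fun w => fderiv ℝ F w v) z v := by
      rw [hg1.deriv_eq]
      simpa [Function.comp_def] using (hF'.hasFDerivAt.comp_hasDerivAt (0 : ℝ) (hline 0)).deriv
    have hgmax : IsLocalMax g 0 := by
      have := hlim.eventually hmax
      simpa [IsLocalMax, IsMaxFilter, hg] using this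
    have hgc : ContinuousAt g 0 := by
      have : ContinuousAt F (z + (0 : ℝ) • v) := by simpa using hF.continuousAt
      exact ContinuousAt.comp this (hline 0).continuousAt
    have hgmin := isLocalMin_of_deriv_deriv_pos (by rw [hg2]; exact hpos) hgmax.deriv_eq_zero hgc
    have hconst : g =ᶠ[𝓝 0] fun _ => g 0 := by
      filter_upwards [hgmax, hgmin] with t h1 h2 using le_antisymm h1 h2
    have h0 : deriv (deriv g) 0 = 0 := by
      rw [hconst.deriv.deriv_eq]
      simp
    rw [hg2] at h0
    exact hpos.ne' h0
  exact add_nonpos (key 1) (key Complex.I)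

/-- Maximum principle: a function whose Laplacian is positive wherever the function is, and whose
boundary values are nonpositive, is nonpositive. -/
theorem nonpos_of_lap_pos {D : Set ℂ} (hD : IsOpen D) (hbdd : Bornology.IsBounded D) {F : ℂ → ℝ}
    (hF : ∀ z ∈ D, ContDiffAt ℝ 2 F z) (hlap : ∀ z ∈ D, 0 < F z → 0 < lap F z)
    (hbd : ∀ p ∈ frontier D, ∀ c : ℝ, 0 < c → ∀ᶠ z in 𝓝[D] p, F z < c) :
    ∀ z ∈ D, F z ≤ 0 := by
  intro z₀ hz₀
  by_contra! hpos
  set K : Set ℂ := {z | z ∈ D ∧ F z₀ ≤ F z} with hK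
  have hKcl : IsClosed K := by
    refine isClosed_of_closure_subset fun p hp => ?_
    have hpD : p ∈ closure D := closure_mono (fun z hz => hz.1) hp
    have hfr : ∃ᶠ z in 𝓝 p, z ∈ K := mem_closure_iff_frequently.1 hp
    by_cases hmem : p ∈ D
    · refine ⟨hmem, ?_⟩
      by_contra! hlt
      obtain ⟨z, hz, hz'⟩ :=
        (hfr.and_eventually ((hF p hmem).continuousAt.eventually (gt_mem_nhds hlt))).exists
      exact absurd hz.2 (not_le.2 hz')
    · have hpf : p ∈ frontier D := by
        rw [hD.frontier_eq]
        exact ⟨hpD, hmem⟩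
      obtain ⟨z, hz, hz'⟩ :=
        (hfr.and_eventually (eventually_nhdsWithin_iff.1 (hbd p hpf _ hpos))).exists
      exact absurd hz.2 (not_le.2 (hz' hz.1))
  have hKc : IsCompact K := isCompact_of_isClosed_isBounded hKcl (hbdd.subset fun z hz => hz.1)
  obtain ⟨m, hmK, hm⟩ := hKc.exists_isMaxOn ⟨z₀, hz₀, le_rfl⟩
    (fun z hz => (hF z hz.1).continuousAt.continuousWithinAt)
  have hloc : IsLocalMax F m := by
    filter_upwards [hD.mem_nhds hmK.1] with z hz
    by_cases h : F z₀ ≤ F z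
    · exact hm ⟨hz, h⟩
    · exact (not_le.1 h).le.trans hmK.2
  exact absurd (lap_nonpos_of_isLocalMax (hF m hmK.1) hloc)
    (not_le.2 (hlap m hmK.1 (hpos.trans_le hmK.2)))

/-! ### Comparison with discs -/

/-- A solution of `Δu = e^{2u}` on a bounded open set, blowing up at the boundary. -/
structure BlowUpSolution (Ω : Set ℂ) (u : ℂ → ℝ) : Prop where
  isOpen : IsOpen Ω
  bounded : Bornology.IsBounded Ω
  contDiffAt : ∀ z ∈ Ω, ContDiffAt ℝ 2 u z
  lap_eq : ∀ z ∈ Ω, lap u z = Real.exp (2 * u z)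
  blow : ∀ p ∈ frontier Ω, Tendsto u (𝓝[Ω] p) atTop

/-- The logarithm of the Poincaré density of the disc of radius `R` about `q`, and also of the
complement of this disc. -/
noncomputable def discSolution (q : ℂ) (R : ℝ) (z : ℂ) : ℝ :=
  Real.log (2 * R) - Real.log (R ^ 2 - ‖z - q‖ ^ 2)

theorem contDiffAt_discSolution {q z : ℂ} {R : ℝ} (h : R ^ 2 - ‖z - q‖ ^ 2 ≠ 0) :
    ContDiffAt ℝ 2 (discSolution q R) z :=
  contDiffAt_const.sub ((contDiffAt_const.sub (contDiff_normSq_sub q).contDiffAt).log h)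

theorem lap_discSolution {q z : ℂ} {R : ℝ} (hR : 0 < R) (h : R ^ 2 - ‖z - q‖ ^ 2 ≠ 0) :
    lap (discSolution q R) z = Real.exp (2 * discSolution q R z) := by
  have hφ : ∀ x : ℝ, R ^ 2 - x ≠ 0 → HasDerivAt
      (fun x => Real.log (2 * R) - Real.log (R ^ 2 - x)) ((R ^ 2 - x)⁻¹) x := by
    intro x hx
    have := (((hasDerivAt_id x).const_sub (R ^ 2)).log hx).const_sub (Real.log (2 * R))
    simpa [neg_div] using this
  have hev : ∀ᶠ x in 𝓝 (‖z - q‖ ^ 2), R ^ 2 - x ≠ 0 :=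
    (continuous_const.sub continuous_id).continuousAt.eventually_ne h
  have hφ₁ : HasDerivAt (fun x => (R ^ 2 - x)⁻¹) (((R ^ 2 - ‖z - q‖ ^ 2) ^ 2)⁻¹)
      (‖z - q‖ ^ 2) := by
    have := ((hasDerivAt_id (‖z - q‖ ^ 2)).const_sub (R ^ 2)).fun_inv h
    simpa using this
  have h1 := lap_radial (hev.mono hφ) hφ₁
  have h2 : Real.exp (2 * discSolution q R z) = (2 * R) ^ 2 / (R ^ 2 - ‖z - q‖ ^ 2) ^ 2 := by
    have e : 2 * discSolution q R z =
        Real.log ((2 * R) ^ 2) - Real.log ((R ^ 2 - ‖z - q‖ ^ 2) ^ 2) := by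
      rw [Real.log_pow, Real.log_pow, discSolution]
      push_cast
      ring
    rw [e, Real.exp_sub, Real.exp_log (by positivity), Real.exp_log (even_two.pow_pos h)]
  rw [h2]
  refine h1.trans ?_
  field_simp
  ring

theorem BlowUpSolution.le_of_closedBall_subset {Ω : Set ℂ} {u : ℂ → ℝ} (hu : BlowUpSolution Ω u)
    {z : ℂ} {R : ℝ} (hR : 0 < R) (hsub : closedBall z R ⊆ Ω) : u z ≤ Real.log (2 / R) := by
  have hne : ∀ w ∈ ball z R, 0 < R ^ 2 - ‖w - z‖ ^ 2 := by
    intro w hw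
    rw [mem_ball, dist_eq_norm] at hw
    have := norm_nonneg (w - z)
    nlinarith
  have hreg : ∀ w ∈ ball z R, ContDiffAt ℝ 2 u w := fun w hw =>
    hu.contDiffAt w (hsub (ball_subset_closedBall hw))
  have key := nonpos_of_lap_pos (F := fun w => u w - discSolution z R w)
    isOpen_ball isBounded_ball
    (fun w hw => (hreg w hw).sub (contDiffAt_discSolution (hne w hw).ne')) ?_ ?_ z
    (mem_ball_self hR)
  · have : discSolution z R z = Real.log (2 / R) := by
      rw [discSolution, sub_self, norm_zero, zero_pow two_ne_zero, sub_zero,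
        ← Real.log_div (by positivity) (by positivity)]
      congr 1
      field_simp
    linarith
  · intro w hw hpos
    rw [lap_sub (hreg w hw) (contDiffAt_discSolution (hne w hw).ne'),
      lap_discSolution hR (hne w hw).ne', hu.lap_eq w (hsub (ball_subset_closedBall hw)), sub_pos,
      Real.exp_lt_exp]
    linarith
  · intro p hp c hc
    rw [frontier_ball z hR.ne', mem_sphere, dist_eq_norm] at hp
    have hpΩ : p ∈ Ω := hsub (by rw [mem_closedBall, dist_eq_norm]; exact hp.le)
    have hlog : Tendsto (fun w => Real.log (R ^ 2 - ‖w - z‖ ^ 2)) (𝓝[ball z R] p) atBot := by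
      refine Real.tendsto_log_nhdsGT_zero.comp (tendsto_nhdsWithin_iff.2 ⟨?_, ?_⟩)
      · have : Continuous fun w : ℂ => R ^ 2 - ‖w - z‖ ^ 2 := by fun_prop
        have h := this.tendsto p
        rw [hp, sub_self] at h
        exact h.mono_left nhdsWithin_le_nhds
      · filter_upwards [self_mem_nhdsWithin] with w hw using hne w hw
    have huc : ∀ᶠ w in 𝓝[ball z R] p, u w < u p + 1 :=
      nhdsWithin_le_nhds
        ((hu.contDiffAt p hpΩ).continuousAt.eventually (gt_mem_nhds (lt_add_one (u p))))
    filter_upwards [huc, hlog.eventually_lt_atBot (c - (u p + 1) + Real.log (2 * R))]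
      with w h1 h2
    simp only [discSolution]
    linarith

theorem BlowUpSolution.le_of_ball_subset {Ω : Set ℂ} {u : ℂ → ℝ} (hu : BlowUpSolution Ω u)
    {z : ℂ} {R : ℝ} (hR : 0 < R) (hsub : ball z R ⊆ Ω) : u z ≤ Real.log (4 / R) := by
  have := hu.le_of_closedBall_subset (half_pos hR)
    ((closedBall_subset_ball (half_lt_self hR)).trans hsub)
  convert this using 2
  field_simp
  norm_num

theorem BlowUpSolution.ge_of_ball_disjoint {Ω : Set ℂ} {u : ℂ → ℝ} (hu : BlowUpSolution Ω u)
    {q : ℂ} {R : ℝ} (hR : 0 < R) (hdisj : Disjoint (ball q R) Ω) {z : ℂ} (hz : z ∈ Ω) :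
    Real.log (R / ‖z - q‖ ^ 2) ≤ u z := by
  have hfar : ∀ w ∈ closure Ω, R ≤ ‖w - q‖ := by
    intro w hw
    by_contra! hlt
    exact (hdisj.closure_right isOpen_ball).le_bot
      ⟨by rwa [mem_ball, dist_eq_norm], hw⟩
  have hne : ∀ w ∈ closure Ω, 0 < ‖w - q‖ ^ 2 - (R / 2) ^ 2 := by
    intro w hw
    have := hfar w hw
    nlinarith
  have hne' : ∀ w ∈ closure Ω, (R / 2) ^ 2 - ‖w - q‖ ^ 2 ≠ 0 := fun w hw =>
    (sub_neg.2 (sub_pos.1 (hne w hw))).ne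
  have key := nonpos_of_lap_pos (F := fun w => discSolution q (R / 2) w - u w)
    hu.isOpen hu.bounded
    (fun w hw => (contDiffAt_discSolution (hne' w (subset_closure hw))).sub
      (hu.contDiffAt w hw)) ?_ ?_ z hz
  · have h0 := hne z (subset_closure hz)
    have h1 : discSolution q (R / 2) z = Real.log (R / (‖z - q‖ ^ 2 - (R / 2) ^ 2)) := by
      rw [discSolution, ← Real.log_neg_eq_log (_ - _), neg_sub, Real.log_div hR.ne' h0.ne']
      congr 2
      ring
    have h2 : Real.log (R / ‖z - q‖ ^ 2) ≤ Real.log (R / (‖z - q‖ ^ 2 - (R / 2) ^ 2)) := by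
      have h3 : 0 < ‖z - q‖ ^ 2 := by nlinarith
      apply Real.log_le_log (by positivity)
      gcongr
      nlinarith
    linarith
  · intro w hw hpos
    have hw' := subset_closure hw
    rw [lap_sub (contDiffAt_discSolution (hne' w hw')) (hu.contDiffAt w hw),
      lap_discSolution (by positivity) (hne' w hw'), hu.lap_eq w hw, sub_pos, Real.exp_lt_exp]
    linarith
  · intro p hp c hc
    have hc1 : ∀ᶠ w in 𝓝[Ω] p, discSolution q (R / 2) w < discSolution q (R / 2) p + 1 :=
      nhdsWithin_le_nhds ((contDiffAt_discSolution
        (hne' p (frontier_subset_closure hp))).continuousAt.eventually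
          (gt_mem_nhds (lt_add_one _)))
    filter_upwards [hc1, (hu.blow p hp).eventually_gt_atTop (discSolution q (R / 2) p + 1 - c)]
      with w h1 h2
    linarith

theorem BlowUpSolution.exists_lowerBound {Ω : Set ℂ} {u : ℂ → ℝ} (hu : BlowUpSolution Ω u) :
    ∃ m : ℝ, ∀ z ∈ Ω, m ≤ u z := by
  obtain ⟨S, hS, hΩ⟩ := hu.bounded.subset_ball_lt 0 0
  have hq : ‖((S + 1 : ℝ) : ℂ)‖ = S + 1 := by
    rw [Complex.norm_real, Real.norm_of_nonneg (by linarith)]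
  refine ⟨Real.log (1 / (2 * S + 1) ^ 2), fun z hz => ?_⟩
  have hzS : ‖z‖ < S := by simpa using hΩ hz
  have hdisj : Disjoint (ball ((S + 1 : ℝ) : ℂ) 1) Ω := by
    refine (ball_disjoint_ball ?_).mono_right hΩ
    rw [dist_zero_right, hq]
    linarith
  refine le_trans ?_ (hu.ge_of_ball_disjoint one_pos hdisj hz)
  have h1 : ‖z - ((S + 1 : ℝ) : ℂ)‖ ≤ 2 * S + 1 := by
    have := norm_sub_le z ((S + 1 : ℝ) : ℂ)
    linarith
  have h2 : 0 < ‖z - ((S + 1 : ℝ) : ℂ)‖ := by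
    have := norm_sub_norm_le ((S + 1 : ℝ) : ℂ) z
    rw [norm_sub_rev] at this
    linarith
  apply Real.log_le_log (by positivity)
  gcongr

/-! ### Two-sided bounds from the exterior cone condition -/

theorem ball_subset_finiteCone {p e : ℂ} {h θ t : ℝ} (he : ‖e‖ = 1) (ht : 0 < t)
    (hth : t ≤ h / 2) (hθ : 0 < Real.cos θ) :
    ball (p + t • e) ((1 - Real.cos θ) / (1 + Real.cos θ) * t) ⊆ finiteCone p e h θ := by
  intro w hw
  set κ := Real.cos θ
  set R := (1 - κ) / (1 + κ) * t with hR
  have hRκ : κ * (t + R) = t - R := by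
    rw [hR]
    field_simp
    ring
  have hRt : R < t := by nlinarith [mul_pos hθ ht]
  set x := w - (p + t • e) with hx
  have hxR : ‖x‖ < R := by rwa [mem_ball, dist_eq_norm] at hw
  set y := t • e + x with hy
  have hwy : w = p + y := by rw [hy, hx]; abel
  have hte : ‖t • e‖ = t := by rw [norm_smul, he, mul_one, Real.norm_of_nonneg ht.le]
  have hy1 : ‖y‖ ≤ t + R := by
    have := norm_add_le (t • e) x
    linarith
  have hy2 : 0 < ‖y‖ := by
    have := norm_sub_norm_le (t • e) (-x)
    rw [norm_neg, sub_neg_eq_add] at this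
    linarith
  have hxe : -R ≤ realInner x e := by
    have h1 := abs_real_inner_le_norm x e
    rw [he, mul_one] at h1
    have h2 : (inner ℝ x e : ℝ) = realInner x e := by simp [Complex.inner, realInner]; ring
    rw [h2] at h1
    linarith [neg_abs_le (realInner x e)]
  have hee : e.re ^ 2 + e.im ^ 2 = 1 := by
    have := Complex.sq_norm e
    rw [he, Complex.normSq_apply] at this
    linarith
  have hye : realInner y e = t + realInner x e := by
    simp only [realInner, hy, Complex.add_re, Complex.add_im, Complex.smul_re, Complex.smul_im,
      smul_eq_mul]
    linear_combination t * hee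
  refine ⟨‖y‖, ‖y‖⁻¹ • y, hy2.le, by linarith, ?_, ?_, ?_⟩
  · rw [norm_smul, norm_inv, norm_norm, inv_mul_cancel₀ hy2.ne']
  · have : realInner (‖y‖⁻¹ • y) e = realInner y e / ‖y‖ := by
      simp only [realInner, Complex.smul_re, Complex.smul_im, smul_eq_mul]
      ring
    rw [this, le_div_iff₀ hy2, hye]
    nlinarith
  · rw [smul_smul, mul_inv_cancel₀ hy2.ne', one_smul, hwy]

/-- Two blow-up solutions on sets coinciding near the boundary point `0` differ by a bounded
amount near `0`. -/
theorem BlowUpSolution.exists_sub_le {Ω₁ Ω₂ : Set ℂ} {u₁ u₂ : ℂ → ℝ}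
    (hu₁ : BlowUpSolution Ω₁ u₁) (hu₂ : BlowUpSolution Ω₂ u₂) {h θ : ℝ} (hh : 0 < h)
    (hθ : 0 < θ) (hθ' : θ < Real.pi / 2) (hcone : UnifExtCone Ω₂ h θ)
    (h0 : (0 : ℂ) ∈ frontier Ω₂) {ρ : ℝ} (hρ : 0 < ρ) (hcoin : Ω₁ ∩ ball 0 ρ = Ω₂ ∩ ball 0 ρ) :
    ∃ M δ : ℝ, 0 < M ∧ 0 < δ ∧ ∀ z ∈ Ω₂ ∩ ball 0 δ, u₁ z - u₂ z ≤ M := by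
  have hκ : 0 < Real.cos θ := Real.cos_pos_of_mem_Ioo ⟨by linarith, hθ'⟩
  have hκ' : Real.cos θ < 1 := by
    rw [← Real.cos_zero]
    exact Real.cos_lt_cos_of_nonneg_of_le_pi_div_two le_rfl hθ'.le hθ
  set k := (1 - Real.cos θ) / (1 + Real.cos θ) with hk
  have hk0 : 0 < k := div_pos (by linarith) (by linarith)
  refine ⟨|Real.log (16 / k)| + 1, min (ρ / 2) (h / 2), by positivity, by positivity, ?_⟩
  rintro z ⟨hz, hzδ⟩
  rw [mem_ball_zero_iff, lt_min_iff] at hzδ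
  have hcl : IsClosed Ω₂ᶜ := hu₂.isOpen.isClosed_compl
  have h0c : (0 : ℂ) ∈ Ω₂ᶜ := by
    rw [hu₂.isOpen.frontier_eq] at h0
    exact h0.2
  obtain ⟨p, hp, hpd⟩ := hcl.exists_infDist_eq_dist ⟨0, h0c⟩ z
  set d := infDist z Ω₂ᶜ with hd
  have hd0 : 0 < d := (hcl.notMem_iff_infDist_pos ⟨0, h0c⟩).1 (by simpa using hz)
  have hdz : d ≤ ‖z‖ := by simpa using infDist_le_dist_of_mem (x := z) h0c
  have hball : ball z d ⊆ Ω₂ := ball_infDist_compl_subset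
  have hball₁ : ball z d ⊆ Ω₁ := by
    intro w hw
    have hwρ : w ∈ ball (0 : ℂ) ρ := by
      rw [mem_ball, dist_eq_norm] at hw
      rw [mem_ball_zero_iff]
      have := norm_add_le (w - z) z
      rw [sub_add_cancel] at this
      linarith [hzδ.1]
    exact (hcoin.symm.subset ⟨hball hw, hwρ⟩).1
  have hpf : p ∈ frontier Ω₂ := by
    rw [hu₂.isOpen.frontier_eq]
    refine ⟨closure_mono hball ?_, hp⟩
    rw [closure_ball z hd0.ne', mem_closedBall, dist_comm, hpd]
  obtain ⟨e, he, hdisj⟩ := hcone p hpf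
  have hsub : ball (p + d • e) (k * d) ⊆ finiteCone p e h θ :=
    ball_subset_finiteCone he hd0 (by linarith [hzδ.2]) hκ
  have hlow := hu₂.ge_of_ball_disjoint (mul_pos hk0 hd0)
    ((disjoint_iff_inter_eq_empty.2 hdisj).mono_left hsub) hz
  have hup := hu₁.le_of_ball_subset hd0 hball₁
  have hq1 : ‖z - (p + d • e)‖ ≤ 2 * d := by
    have h1 := norm_sub_le (z - p) (d • e)
    rw [← dist_eq_norm z p, ← hpd, norm_smul, he, Real.norm_of_nonneg hd0.le, sub_sub] at h1
    linarith
  have hq2 : 0 < ‖z - (p + d • e)‖ := by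
    rw [norm_pos_iff, sub_ne_zero]
    intro hzq
    exact (Set.eq_empty_iff_forall_notMem.1 hdisj) _
      ⟨hsub (mem_ball_self (mul_pos hk0 hd0)), hzq ▸ hz⟩
  have hlow' : Real.log (k * d / (2 * d) ^ 2) ≤ u₂ z := by
    refine le_trans (Real.log_le_log (by positivity) ?_) hlow
    gcongr
  have : Real.log (4 / d) - Real.log (k * d / (2 * d) ^ 2) = Real.log (16 / k) := by
    rw [← Real.log_div (by positivity) (by positivity)]
    congr 1
    field_simp
    norm_num
  linarith [le_abs_self (Real.log (16 / k))]

/-! ### Comparison with sectors -/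

theorem frontier_inter_ball_cases {Ω : Set ℂ} (hΩ : IsOpen Ω) {q p : ℂ} {r : ℝ}
    (hp : p ∈ frontier (Ω ∩ ball q r)) : p ∈ frontier Ω ∨ (p ∈ Ω ∧ ‖p - q‖ = r) := by
  rw [(hΩ.inter isOpen_ball).frontier_eq] at hp
  obtain ⟨hcl, hnot⟩ := hp
  by_cases hmem : p ∈ Ω
  · refine Or.inr ⟨hmem, le_antisymm ?_ ?_⟩
    · have := closure_ball_subset_closedBall (closure_mono inter_subset_right hcl)
      rwa [mem_closedBall, dist_eq_norm] at this
    · by_contra! hlt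
      exact hnot ⟨hmem, by rwa [mem_ball, dist_eq_norm]⟩
  · left
    rw [hΩ.frontier_eq]
    exact ⟨closure_mono inter_subset_left hcl, hmem⟩

theorem contDiffAt_re_of_analyticAt {f : ℂ → ℂ} {z : ℂ} (hf : AnalyticAt ℂ f z) :
    ContDiffAt ℝ 2 (fun w => (f w).re) z :=
  hf.harmonicAt_re.1

theorem lap_re_of_analyticAt {f : ℂ → ℂ} {z : ℂ} (hf : AnalyticAt ℂ f z) :
    lap (fun w => (f w).re) z = 0 := by
  rw [lap_eq_laplacian hf.harmonicAt_re.1]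
  exact hf.harmonicAt_re.2.self_of_nhds

theorem contDiffAt_re_sub_log_re {G f : ℂ → ℂ} {z : ℂ} (hG : AnalyticAt ℂ G z)
    (hf : AnalyticAt ℂ f z) (hpos : 0 < (f z).re) :
    ContDiffAt ℝ 2 (fun w => (G w).re - Real.log (f w).re) z :=
  (contDiffAt_re_of_analyticAt hG).sub ((contDiffAt_re_of_analyticAt hf).log hpos.ne')

theorem lap_re_sub_log_re {G f : ℂ → ℂ} {z : ℂ} (hG : AnalyticAt ℂ G z)
    (hf : AnalyticAt ℂ f z) (hpos : 0 < (f z).re) :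
    lap (fun w => (G w).re - Real.log (f w).re) z = ‖deriv f z‖ ^ 2 / (f z).re ^ 2 := by
  have hcf := contDiffAt_re_of_analyticAt hf
  have hev : ∀ᶠ x in 𝓝 (f z).re, HasDerivAt Real.log (x⁻¹) x := by
    filter_upwards [lt_mem_nhds hpos] with x hx using Real.hasDerivAt_log hx.ne'
  have h1 := lap_comp hcf hev (hasDerivAt_inv hpos.ne')
  have hd : ∀ v : ℂ, fderiv ℝ (fun w => (f w).re) z v = (deriv f z * v).re := by
    intro v
    have hF := (Complex.reCLM.hasFDerivAt (x := f z)).comp z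
      (hf.differentiableAt.hasDerivAt.hasFDerivAt.restrictScalars ℝ)
    refine (congrArg (fun L : ℂ →L[ℝ] ℝ => L v) hF.fderiv).trans ?_
    simp [mul_comm]
  rw [lap_sub (contDiffAt_re_of_analyticAt hG) (hcf.log hpos.ne'), lap_re_of_analyticAt hG, h1,
    lap_re_of_analyticAt hf, hd, hd, Complex.sq_norm, Complex.normSq_apply]
  simp
  field_simp

/-- The logarithm of the Poincaré density of a sector with vertex `0` and opening `νπ`, diminished
by a positive harmonic function vanishing at `0` if `η = 0`. -/
noncomputable def sectorSubsolution (ν K η : ℝ) (c z : ℂ) : ℝ :=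
  ((((1 / ν - 1 : ℝ) : ℂ) * Complex.log (c * z) - (K : ℂ) * Complex.exp (Complex.log (c * z) / 3)
    - (η : ℂ) * Complex.exp (-(Complex.log (c * z) / 3))) - (Real.log ν : ℂ)).re
    - Real.log (Complex.exp (((1 / ν : ℝ) : ℂ) * Complex.log (c * z))).re

theorem re_exp_mul_log (x : ℝ) {c z : ℂ} (hc : ‖c‖ = 1) :
    (Complex.exp ((x : ℂ) * Complex.log (c * z))).re =
      Real.exp (x * Real.log ‖z‖) * Real.cos (x * Complex.arg (c * z)) := by
  rw [Complex.exp_re, Complex.re_ofReal_mul, Complex.im_ofReal_mul, Complex.log_re,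
    Complex.log_im, norm_mul, hc, one_mul]

theorem sectorSubsolution_eq {ν K η : ℝ} {c z : ℂ} (hc : ‖c‖ = 1)
    (hcos : 0 < Real.cos (1 / ν * Complex.arg (c * z))) :
    sectorSubsolution ν K η c z = -Real.log ν - Real.log ‖z‖
      - Real.log (Real.cos (1 / ν * Complex.arg (c * z)))
      - (K * Real.exp (Real.log ‖z‖ / 3) + η * Real.exp (-(Real.log ‖z‖ / 3)))
        * Real.cos (Complex.arg (c * z) / 3) := by
  have h3 : Complex.log (c * z) / 3 = ((1 / 3 : ℝ) : ℂ) * Complex.log (c * z) := by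
    push_cast
    ring
  have h3' : -(((1 / 3 : ℝ) : ℂ) * Complex.log (c * z)) =
      ((-(1 / 3) : ℝ) : ℂ) * Complex.log (c * z) := by
    push_cast
    ring
  rw [sectorSubsolution, re_exp_mul_log _ hc, Real.log_mul (Real.exp_pos _).ne' hcos.ne',
    Real.log_exp, h3, h3', Complex.sub_re, Complex.sub_re, Complex.sub_re, Complex.re_ofReal_mul,
    Complex.re_ofReal_mul, Complex.re_ofReal_mul, re_exp_mul_log _ hc, re_exp_mul_log _ hc,
    Complex.log_re, Complex.ofReal_re,
    norm_mul, hc, one_mul, neg_mul, neg_mul, Real.cos_neg, one_div_mul_eq_div 3,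
    one_div_mul_eq_div 3]
  ring

theorem half_le_cos_arg_div_three (z : ℂ) : 1 / 2 ≤ Real.cos (Complex.arg z / 3) := by
  rw [← Real.cos_pi_div_three, ← Real.cos_abs (Complex.arg z / 3)]
  have h := Complex.abs_arg_le_pi z
  apply Real.cos_le_cos_of_nonneg_of_le_pi (abs_nonneg _)
  · linarith [Real.pi_pos]
  · rw [abs_div, abs_of_pos (three_pos : (0 : ℝ) < 3)]
    linarith

theorem sectorSubsolution_le {ν K η : ℝ} {c z : ℂ} (hK : 0 ≤ K) (hη : 0 ≤ η) (hc : ‖c‖ = 1)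
    (hcos : 0 < Real.cos (1 / ν * Complex.arg (c * z))) :
    sectorSubsolution ν K η c z ≤ -Real.log ν - Real.log ‖z‖
      - Real.log (Real.cos (1 / ν * Complex.arg (c * z)))
      - (K * Real.exp (Real.log ‖z‖ / 3) + η * Real.exp (-(Real.log ‖z‖ / 3))) / 2 := by
  rw [sectorSubsolution_eq hc hcos]
  have h1 : 0 ≤ K * Real.exp (Real.log ‖z‖ / 3) + η * Real.exp (-(Real.log ‖z‖ / 3)) := by
    positivity
  nlinarith [half_le_cos_arg_div_three (c * z)]

theorem sectorSubsolution_spec {ν K η : ℝ} {c z : ℂ} (hν : 0 < ν) (hK : 0 ≤ K) (hη : 0 ≤ η)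
    (hc : ‖c‖ = 1) (hz : c * z ∈ Complex.slitPlane)
    (hcos : 0 < Real.cos (1 / ν * Complex.arg (c * z))) :
    ContDiffAt ℝ 2 (sectorSubsolution ν K η c) z ∧
      Real.exp (2 * sectorSubsolution ν K η c z) ≤ lap (sectorSubsolution ν K η c) z := by
  have hL : AnalyticAt ℂ (fun w => Complex.log (c * w)) z :=
    (analyticAt_const.mul analyticAt_id).clog hz
  have hG : AnalyticAt ℂ (fun w => (((1 / ν - 1 : ℝ) : ℂ) * Complex.log (c * w)
      - (K : ℂ) * Complex.exp (Complex.log (c * w) / 3)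
      - (η : ℂ) * Complex.exp (-(Complex.log (c * w) / 3))) - (Real.log ν : ℂ)) z := by
    have h3 : AnalyticAt ℂ (fun w => Complex.log (c * w) / 3) z :=
      hL.div analyticAt_const three_ne_zero
    exact (((analyticAt_const.mul hL).sub (analyticAt_const.mul h3.cexp)).sub
      (analyticAt_const.mul h3.neg.cexp)).sub analyticAt_const
  have hf : AnalyticAt ℂ (fun w => Complex.exp (((1 / ν : ℝ) : ℂ) * Complex.log (c * w))) z :=
    (analyticAt_const.mul hL).cexp
  have hre := re_exp_mul_log (1 / ν) (z := z) hc
  have hpos : 0 < (Complex.exp (((1 / ν : ℝ) : ℂ) * Complex.log (c * z))).re := by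
    rw [hre]
    positivity
  refine ⟨contDiffAt_re_sub_log_re hG hf hpos, ?_⟩
  have hcz : c * z ≠ 0 := Complex.slitPlane_ne_zero hz
  have hz0 : 0 < ‖z‖ := norm_pos_iff.2 (right_ne_zero_of_mul hcz)
  have hderiv : ‖deriv (fun w => Complex.exp (((1 / ν : ℝ) : ℂ) * Complex.log (c * w))) z‖ =
      Real.exp (1 / ν * Real.log ‖z‖) / (ν * ‖z‖) := by
    have h1 : HasDerivAt (fun w => Complex.log (c * w)) (c / (c * z)) z := by
      simpa using ((hasDerivAt_id z).const_mul c).clog hz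
    rw [((h1.const_mul ((1 / ν : ℝ) : ℂ)).cexp).deriv, norm_mul, Complex.norm_exp,
      Complex.re_ofReal_mul, Complex.log_re, norm_mul c z, norm_mul, norm_div, norm_mul, hc, one_mul,
      Complex.norm_real, Real.norm_of_nonneg (by positivity)]
    field_simp
  have hlap : lap (sectorSubsolution ν K η c) z =
      (1 / (ν * ‖z‖ * Real.cos (1 / ν * Complex.arg (c * z)))) ^ 2 := by
    refine (lap_re_sub_log_re hG hf hpos).trans ?_
    rw [hderiv, hre]
    field_simp
  rw [hlap]
  have hle := sectorSubsolution_le hK hη hc hcos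
  have h2 : 0 ≤ K * Real.exp (Real.log ‖z‖ / 3) + η * Real.exp (-(Real.log ‖z‖ / 3)) := by
    positivity
  have h3 : Real.log ((1 / (ν * ‖z‖ * Real.cos (1 / ν * Complex.arg (c * z)))) ^ 2) =
      2 * (-Real.log ν - Real.log ‖z‖ - Real.log (Real.cos (1 / ν * Complex.arg (c * z)))) := by
    rw [Real.log_pow, one_div, Real.log_inv, Real.log_mul (by positivity) hcos.ne',
      Real.log_mul hν.ne' hz0.ne']
    push_cast
    ring
  rw [← Real.le_log_iff_exp_le (by positivity), h3]
  linarith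

/-- A blow-up solution on a set which near `0` lies in a sector of opening less than `νπ` is
asymptotically at least the logarithm of the Poincaré density of a sector of opening `νπ`. -/
theorem BlowUpSolution.sector_lowerBound {Ω : Set ℂ} {u : ℂ → ℝ} (hu : BlowUpSolution Ω u)
    {c : ℂ} (hc : ‖c‖ = 1) {r₀ ν a : ℝ} (hr₀ : 0 < r₀) (hν : 0 < ν) (ha0 : 0 ≤ a)
    (ha : a < ν * (Real.pi / 2))
    (hsec : ∀ z ∈ Ω, ‖z‖ < r₀ → c * z ∈ Complex.slitPlane ∧ |Complex.arg (c * z)| ≤ a) :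
    ∃ K δ : ℝ, 0 ≤ K ∧ 0 < δ ∧ ∀ z ∈ Ω ∩ ball 0 δ,
      -Real.log ν - Real.log ‖z‖ - K * Real.exp (Real.log ‖z‖ / 3) ≤ u z := by
  obtain ⟨m, hm⟩ := hu.exists_lowerBound
  set κ := Real.cos (1 / ν * a) with hκ
  have haν : 1 / ν * a < Real.pi / 2 := by
    rw [one_div_mul_eq_div, div_lt_iff₀ hν]
    linarith
  have haν0 : 0 ≤ 1 / ν * a := by positivity
  have hκ0 : 0 < κ := Real.cos_pos_of_mem_Ioo ⟨by linarith [Real.pi_pos], haν⟩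
  have hcosκ : ∀ z ∈ Ω, ‖z‖ < r₀ → κ ≤ Real.cos (1 / ν * Complex.arg (c * z)) := by
    intro z hz hzr
    rw [← Real.cos_abs (1 / ν * Complex.arg (c * z)), abs_mul,
      abs_of_pos (by positivity : 0 < 1 / ν)]
    apply Real.cos_le_cos_of_nonneg_of_le_pi (by positivity) (by linarith [Real.pi_pos])
    gcongr
    exact (hsec z hz hzr).2
  set r₁ := r₀ / 2 with hr₁
  have hr₁0 : 0 < r₁ := by positivity
  set T := -Real.log ν - Real.log r₁ - Real.log κ - m with hT
  set K := 2 * |T| / Real.exp (Real.log r₁ / 3) with hK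
  have hK0 : 0 ≤ K := by positivity
  refine ⟨K, r₁, hK0, hr₁0, ?_⟩
  have hmain : ∀ η : ℝ, 0 < η → ∀ z ∈ Ω ∩ ball 0 r₁, sectorSubsolution ν K η c z - u z ≤ 0 := by
    intro η hη
    have hlt : ∀ z ∈ Ω ∩ ball 0 r₁, ‖z‖ < r₀ := fun z hz => by
      have := mem_ball_zero_iff.1 hz.2
      linarith
    have hspec : ∀ z ∈ Ω, ‖z‖ < r₀ → _ := fun z hz hzr =>
      sectorSubsolution_spec hν hK0 hη.le hc (hsec z hz hzr).1 (hκ0.trans_le (hcosκ z hz hzr))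
    have hle : ∀ z ∈ Ω, ‖z‖ < r₀ → sectorSubsolution ν K η c z ≤
        -Real.log ν - Real.log ‖z‖ - Real.log κ
          - (K * Real.exp (Real.log ‖z‖ / 3) + η * Real.exp (-(Real.log ‖z‖ / 3))) / 2 := by
      intro z hz hzr
      have h1 := sectorSubsolution_le hK0 hη.le hc (hκ0.trans_le (hcosκ z hz hzr))
      have h2 := Real.log_le_log hκ0 (hcosκ z hz hzr)
      linarith
    refine nonpos_of_lap_pos (hu.isOpen.inter isOpen_ball) (hu.bounded.subset inter_subset_left)
      (fun z hz => (hspec z hz.1 (hlt z hz)).1.sub (hu.contDiffAt z hz.1)) ?_ ?_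
    · intro z hz hpos
      obtain ⟨h1, h2⟩ := hspec z hz.1 (hlt z hz)
      rw [lap_sub h1 (hu.contDiffAt z hz.1), hu.lap_eq z hz.1, sub_pos]
      refine lt_of_lt_of_le (Real.exp_lt_exp.2 ?_) h2
      linarith
    · intro p hp ε hε
      rcases frontier_inter_ball_cases hu.isOpen hp with hp | ⟨hp, hpr⟩
      · have hbig := (hu.blow p hp).eventually_gt_atTop
          (-Real.log ν - Real.log κ - 3 * (Real.log (η / 6) + 1) - ε)
        filter_upwards [nhdsWithin_mono p inter_subset_left hbig, self_mem_nhdsWithin] with z h1 hz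
        have h2 := hle z hz.1 (hlt z hz)
        have h3 := Real.add_one_le_exp (-(Real.log ‖z‖ / 3) + Real.log (η / 6))
        rw [Real.exp_add, Real.exp_log (by positivity)] at h3
        have h4 : 0 ≤ K * Real.exp (Real.log ‖z‖ / 3) := by positivity
        linarith
      · rw [sub_zero] at hpr
        have hpr₀ : ‖p‖ < r₀ := by linarith
        have hcont : ContinuousAt (fun w => sectorSubsolution ν K η c w - u w) p :=
          (hspec p hp hpr₀).1.continuousAt.sub (hu.contDiffAt p hp).continuousAt
        refine nhdsWithin_le_nhds (hcont.eventually (gt_mem_nhds ?_))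
        have h1 := hle p hp hpr₀
        rw [hpr] at h1
        have h2 : K * Real.exp (Real.log r₁ / 3) = 2 * |T| :=
          div_mul_cancel₀ _ (Real.exp_pos _).ne'
        have h3 : 0 < η * Real.exp (-(Real.log r₁ / 3)) := by positivity
        linarith [hm p hp, le_abs_self T]
  intro z hz
  have hzr : ‖z‖ < r₀ := by
    have := mem_ball_zero_iff.1 hz.2
    linarith
  have hcos := hκ0.trans_le (hcosκ z hz.1 hzr)
  have hlim : Tendsto (fun η : ℝ => -Real.log ν - Real.log ‖z‖
      - (K * Real.exp (Real.log ‖z‖ / 3) + η * Real.exp (-(Real.log ‖z‖ / 3)))) (𝓝[>] 0)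
      (𝓝 (-Real.log ν - Real.log ‖z‖ - K * Real.exp (Real.log ‖z‖ / 3))) := by
    have : Continuous fun η : ℝ => -Real.log ν - Real.log ‖z‖
        - (K * Real.exp (Real.log ‖z‖ / 3) + η * Real.exp (-(Real.log ‖z‖ / 3))) := by fun_prop
    simpa using (this.tendsto 0).mono_left nhdsWithin_le_nhds
  refine le_of_tendsto hlim ?_
  filter_upwards [self_mem_nhdsWithin] with η hη
  have h1 := hmain η hη z hz
  rw [sectorSubsolution_eq hc hcos] at h1
  have hη0 : (0 : ℝ) < η := hη
  have h2 : 0 ≤ K * Real.exp (Real.log ‖z‖ / 3) + η * Real.exp (-(Real.log ‖z‖ / 3)) := by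
    positivity
  have h3 := Real.log_nonpos hcos.le (Real.cos_le_one _)
  have h4 := mul_le_mul_of_nonneg_left (Real.cos_le_one (Complex.arg (c * z) / 3)) h2
  linarith

theorem abs_arg_le_of_mem_sector {μ ε r₀ : ℝ} {z : ℂ} (hμ : μ * Real.pi / 2 + ε < Real.pi)
    (hz : z ∈ sector (-ε) (μ * Real.pi + ε) r₀) :
    Complex.exp ((-(μ * Real.pi / 2) : ℝ) * Complex.I) * z ∈ Complex.slitPlane ∧
      |Complex.arg (Complex.exp ((-(μ * Real.pi / 2) : ℝ) * Complex.I) * z)| ≤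
        μ * Real.pi / 2 + ε := by
  obtain ⟨r, t, hr, -, ht1, ht2, rfl⟩ := hz
  set s := t - μ * Real.pi / 2 with hs
  have heq : Complex.exp ((-(μ * Real.pi / 2) : ℝ) * Complex.I) *
      ((r : ℂ) * Complex.exp ((t : ℂ) * Complex.I)) =
      (r : ℂ) * (Complex.cos s + Complex.sin s * Complex.I) := by
    rw [← Complex.exp_mul_I, mul_left_comm, ← Complex.exp_add]
    congr 2
    rw [hs]
    push_cast
    ring
  have hsabs : |s| < μ * Real.pi / 2 + ε := abs_lt.2 ⟨by linarith, by linarith⟩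
  have hsπ := abs_lt.1 (hsabs.trans hμ)
  have harg : Complex.arg ((r : ℂ) * (Complex.cos s + Complex.sin s * Complex.I)) = s :=
    Complex.arg_mul_cos_add_sin_mul_I hr ⟨hsπ.1, hsπ.2.le⟩
  rw [heq, Complex.mem_slitPlane_iff_arg, harg]
  refine ⟨⟨hsπ.2.ne, ?_⟩, hsabs.le⟩
  rw [← Complex.exp_mul_I]
  exact mul_ne_zero (by exact_mod_cast hr.ne') (Complex.exp_ne_zero _)

theorem BlowUpSolution.exists_exp_ge {Ω : Set ℂ} {u : ℂ → ℝ} (hu : BlowUpSolution Ω u) {μ : ℝ}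
    (hμ0 : 0 < μ) (hμ2 : μ < 2)
    (hcone : ∀ ε : ℝ, 0 < ε → ∃ r₀ : ℝ, 0 < r₀ ∧ ∃ r₁ : ℝ,
      Ω ∩ ball 0 r₀ ⊆ sector (-ε) (μ * Real.pi + ε) r₁) :
    ∃ δ : ℝ, 0 < δ ∧ ∀ z ∈ Ω ∩ ball 0 δ, z ≠ 0 →
      1 / (2 * μ ^ 2 * ‖z‖ ^ 2) ≤ Real.exp (2 * u z) := by
  have hπ := Real.pi_pos
  set ν := min ((μ + 2) / 2) (6 / 5 * μ) with hν
  have hν1 : μ < ν := lt_min (by linarith) (by linarith)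
  have hν2 : ν < 2 := (min_le_left _ _).trans_lt (by linarith)
  have hν3 : ν ≤ 6 / 5 * μ := min_le_right _ _
  have hν0 : 0 < ν := hμ0.trans hν1
  set ε := (ν - μ) * Real.pi / 4 with hε
  have hε0 : 0 < ε := by
    have : 0 < ν - μ := by linarith
    positivity
  obtain ⟨r₀, hr₀, r₁, hsub⟩ := hcone ε hε0
  have ha : μ * Real.pi / 2 + ε < ν * (Real.pi / 2) := by nlinarith
  have ha' : μ * Real.pi / 2 + ε < Real.pi := by nlinarith
  obtain ⟨K, δ, hK, hδ, hlow⟩ := hu.sector_lowerBound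
    (c := Complex.exp ((-(μ * Real.pi / 2) : ℝ) * Complex.I))
    (Complex.norm_exp_ofReal_mul_I _) hr₀ hν0 (by positivity) ha
    (fun z hz hzr => abs_arg_le_of_mem_sector ha' (hsub ⟨hz, mem_ball_zero_iff.2 hzr⟩))
  set τ := 1 / (10 * (K + 1)) with hτ
  have hτ0 : 0 < τ := by positivity
  have hKτ : K * τ ≤ 1 / 10 := by
    rw [hτ, mul_one_div, div_le_div_iff₀ (by positivity) (by norm_num)]
    linarith
  refine ⟨min δ (Real.exp (3 * Real.log τ)), by positivity, ?_⟩
  rintro z ⟨hz, hzδ⟩ hz0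
  rw [mem_ball_zero_iff, lt_min_iff] at hzδ
  have hz0' : 0 < ‖z‖ := norm_pos_iff.2 hz0
  have h1 := hlow z ⟨hz, mem_ball_zero_iff.2 hzδ.1⟩
  have h2 : Real.exp (Real.log ‖z‖ / 3) ≤ τ := by
    have h3 := (Real.log_lt_iff_lt_exp hz0').2 hzδ.2
    rw [← Real.le_log_iff_exp_le hτ0]
    linarith
  have h3 : K * Real.exp (Real.log ‖z‖ / 3) ≤ 1 / 10 :=
    (mul_le_mul_of_nonneg_left h2 hK).trans hKτ
  have h4 : Real.exp (2 * (-Real.log ν - Real.log ‖z‖ - 1 / 10)) ≤ Real.exp (2 * u z) :=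
    Real.exp_le_exp.2 (by linarith)
  refine le_trans ?_ h4
  have h5 : Real.exp (2 * (-Real.log ν - Real.log ‖z‖ - 1 / 10)) =
      Real.exp (-(1 / 5)) / (ν ^ 2 * ‖z‖ ^ 2) := by
    have : 2 * (-Real.log ν - Real.log ‖z‖ - 1 / 10) =
        -(1 / 5) - Real.log (ν ^ 2 * ‖z‖ ^ 2) := by
      rw [Real.log_mul (by positivity) (by positivity), Real.log_pow, Real.log_pow]
      push_cast
      ring
    rw [this, Real.exp_sub, Real.exp_log (by positivity)]
  rw [h5, div_le_div_iff₀ (by positivity) (by positivity)]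
  have h6 : 4 / 5 ≤ Real.exp (-(1 / 5)) := by
    have := Real.add_one_le_exp (-(1 / 5) : ℝ)
    linarith
  have h7 : ν ^ 2 ≤ (6 / 5 * μ) ^ 2 := by gcongr
  have h8 : ν ^ 2 * ‖z‖ ^ 2 ≤ (6 / 5 * μ) ^ 2 * ‖z‖ ^ 2 := by gcongr
  have h9 : 4 / 5 * (2 * μ ^ 2 * ‖z‖ ^ 2) ≤ Real.exp (-(1 / 5)) * (2 * μ ^ 2 * ‖z‖ ^ 2) := by
    gcongr
  have h10 : 0 ≤ μ ^ 2 * ‖z‖ ^ 2 := by positivity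
  nlinarith

/-! ### Localization -/

theorem rpow_normSq_spec {b : ℝ} {z : ℂ} (hz : z ≠ 0) :
    ContDiffAt ℝ 2 (fun w : ℂ => (‖w - 0‖ ^ 2) ^ b) z ∧
      lap (fun w : ℂ => (‖w - 0‖ ^ 2) ^ b) z = 4 * b ^ 2 * (‖z‖ ^ 2) ^ b / ‖z‖ ^ 2 := by
  have hN : 0 < ‖z - 0‖ ^ 2 := by
    have := norm_pos_iff.2 hz
    rw [sub_zero]
    positivity
  refine ⟨(contDiff_normSq_sub 0).contDiffAt.rpow_const_of_ne hN.ne', ?_⟩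
  have hφ : ∀ᶠ x in 𝓝 (‖z - 0‖ ^ 2), HasDerivAt (fun x : ℝ => x ^ b) (b * x ^ (b - 1)) x := by
    filter_upwards [lt_mem_nhds hN] with x hx using Real.hasDerivAt_rpow_const (Or.inl hx.ne')
  have hφ₁ := (Real.hasDerivAt_rpow_const (p := b - 1) (Or.inl hN.ne')).const_mul b
  rw [lap_radial hφ hφ₁]
  rw [sub_zero] at hN ⊢
  rw [Real.rpow_sub_one hN.ne' (b - 1), Real.rpow_sub_one hN.ne' b]
  field_simp
  ring

/-- One-sided localization estimate at the vertex of a corner. -/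
theorem BlowUpSolution.exists_sub_le_rpow {Ω₁ Ω₂ : Set ℂ} {u₁ u₂ : ℂ → ℝ}
    (hu₁ : BlowUpSolution Ω₁ u₁) (hu₂ : BlowUpSolution Ω₂ u₂) {h θ : ℝ} (hh : 0 < h)
    (hθ : 0 < θ) (hθ' : θ < Real.pi / 2) (hext : UnifExtCone Ω₂ h θ)
    (h0 : (0 : ℂ) ∈ frontier Ω₂) {ρ : ℝ} (hρ : 0 < ρ) (hcoin : Ω₁ ∩ ball 0 ρ = Ω₂ ∩ ball 0 ρ)
    {μ : ℝ} (hμ0 : 0 < μ) (hμ2 : μ < 2)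
    (hcone : ∀ ε : ℝ, 0 < ε → ∃ r₀ : ℝ, 0 < r₀ ∧ ∃ r₁ : ℝ,
      Ω₂ ∩ ball 0 r₀ ⊆ sector (-ε) (μ * Real.pi + ε) r₁) :
    ∃ C δ : ℝ, 0 < C ∧ 0 < δ ∧ ∀ z ∈ Ω₂ ∩ ball 0 δ, u₁ z - u₂ z ≤ C * ‖z‖ ^ (1 / μ) := by
  obtain ⟨M, δ₁, hM, hδ₁, hbound⟩ := hu₁.exists_sub_le hu₂ hh hθ hθ' hext h0 hρ hcoin
  obtain ⟨δ₂, hδ₂, hexp⟩ := hu₂.exists_exp_ge hμ0 hμ2 hcone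
  obtain ⟨m, hm⟩ := hu₂.exists_lowerBound
  set δ := min ρ (min δ₁ δ₂) / 2 with hδ
  have hδ0 : 0 < δ := by positivity
  have hδm : δ < min ρ (min δ₁ δ₂) := half_lt_self (by positivity)
  have hδρ : δ < ρ := hδm.trans_le (min_le_left _ _)
  have hδδ₁ : δ < δ₁ := hδm.trans_le ((min_le_right _ _).trans (min_le_left _ _))
  have hδδ₂ : δ < δ₂ := hδm.trans_le ((min_le_right _ _).trans (min_le_right _ _))
  have hne : ∀ z ∈ Ω₂, z ≠ 0 := by
    rintro z hz rfl
    rw [hu₂.isOpen.frontier_eq] at h0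
    exact h0.2 hz
  have hmem : ∀ z ∈ Ω₂, ‖z‖ ≤ δ → z ∈ Ω₁ := fun z hz hzδ =>
    (hcoin.symm.subset ⟨hz, mem_ball_zero_iff.2 (by linarith)⟩).1
  set b := 1 / (2 * μ) with hb
  have hb0 : 0 < b := by positivity
  set C := M / (δ ^ 2) ^ b with hC
  have hC0 : 0 < C := by positivity
  refine ⟨C, δ, hC0, hδ0, ?_⟩
  have hmain : ∀ η : ℝ, 0 < η → ∀ z ∈ Ω₂ ∩ ball 0 δ,
      (u₁ z - u₂ z) - (C * (‖z - 0‖ ^ 2) ^ b + η * (u₂ z + (1 / 2 - m))) ≤ 0 := by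
    intro η hη
    have hreg : ∀ z ∈ Ω₂, ‖z‖ ≤ δ → ContDiffAt ℝ 2 u₁ z ∧ ContDiffAt ℝ 2 u₂ z := fun z hz hzδ =>
      ⟨hu₁.contDiffAt z (hmem z hz hzδ), hu₂.contDiffAt z hz⟩
    have hregw : ∀ z ∈ Ω₂, ‖z‖ ≤ δ →
        ContDiffAt ℝ 2 (fun z => C * (‖z - 0‖ ^ 2) ^ b) z ∧
          ContDiffAt ℝ 2 (fun z => η * (u₂ z + (1 / 2 - m))) z := fun z hz hzδ =>
      ⟨contDiffAt_const.mul (rpow_normSq_spec (hne z hz)).1,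
        contDiffAt_const.mul ((hreg z hz hzδ).2.add contDiffAt_const)⟩
    have hregF : ∀ z ∈ Ω₂, ‖z‖ ≤ δ → ContDiffAt ℝ 2 (fun z => (u₁ z - u₂ z) -
        (C * (‖z - 0‖ ^ 2) ^ b + η * (u₂ z + (1 / 2 - m)))) z := fun z hz hzδ =>
      ((hreg z hz hzδ).1.sub (hreg z hz hzδ).2).sub ((hregw z hz hzδ).1.add (hregw z hz hzδ).2)
    have hle : ∀ z ∈ Ω₂ ∩ ball 0 δ, ‖z‖ ≤ δ := fun z hz => (mem_ball_zero_iff.1 hz.2).le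
    have hH : ∀ z ∈ Ω₂, 1 / 2 ≤ u₂ z + (1 / 2 - m) := fun z hz => by linarith [hm z hz]
    refine nonpos_of_lap_pos (hu₂.isOpen.inter isOpen_ball)
      (hu₂.bounded.subset inter_subset_left) (fun z hz => hregF z hz.1 (hle z hz)) ?_ ?_
    · intro z hz hpos
      have hzδ := hle z hz
      obtain ⟨hr1, hr2⟩ := hreg z hz.1 hzδ
      obtain ⟨hr3, hr4⟩ := hregw z hz.1 hzδ
      have hz0 := hne z hz.1
      have hN : 0 < ‖z‖ ^ 2 := by
        have := norm_pos_iff.2 hz0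
        positivity
      rw [lap_sub (hr1.sub hr2) (hr3.add hr4), lap_sub hr1 hr2, lap_add hr3 hr4,
        lap_const_mul _ (rpow_normSq_spec hz0).1, (rpow_normSq_spec hz0).2,
        lap_const_mul _ (hr2.add contDiffAt_const), lap_add hr2 contDiffAt_const, lap_const,
        hu₁.lap_eq z (hmem z hz.1 hzδ), hu₂.lap_eq z hz.1, add_zero]
      rw [sub_zero] at hpos
      set E := Real.exp (2 * u₂ z) with hE
      have hE0 : 0 < E := Real.exp_pos _
      set q := (‖z‖ ^ 2) ^ b with hq
      have hq0 : 0 < q := by positivity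
      have h1 : E * (2 * (u₁ z - u₂ z) + 1) ≤ Real.exp (2 * u₁ z) := by
        have h2 : Real.exp (2 * u₁ z) = E * Real.exp (2 * (u₁ z - u₂ z)) := by
          rw [hE, ← Real.exp_add]
          ring_nf
        rw [h2]
        exact mul_le_mul_of_nonneg_left (Real.add_one_le_exp _) hE0.le
      have h3 : 4 * b ^ 2 * q / ‖z‖ ^ 2 ≤ 2 * E * q := by
        have h4 := hexp z ⟨hz.1, mem_ball_zero_iff.2 (hzδ.trans_lt hδδ₂)⟩ hz0
        have h5 : 4 * b ^ 2 * q / ‖z‖ ^ 2 = 2 * (1 / (2 * μ ^ 2 * ‖z‖ ^ 2)) * q := by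
          rw [hb]
          field_simp
          norm_num
        rw [h5]
        gcongr
      have h6 : C * (4 * b ^ 2 * q / ‖z‖ ^ 2) ≤ C * (2 * E * q) :=
        mul_le_mul_of_nonneg_left h3 hC0.le
      have h7 : E * (C * q + η * (u₂ z + (1 / 2 - m))) < E * (u₁ z - u₂ z) :=
        mul_lt_mul_of_pos_left (by linarith) hE0
      have h8 : η * E * (1 / 2) ≤ η * E * (u₂ z + (1 / 2 - m)) :=
        mul_le_mul_of_nonneg_left (hH z hz.1) (by positivity)
      nlinarith
    · intro p hp ε hε
      rcases frontier_inter_ball_cases hu₂.isOpen hp with hp | ⟨hp, hpr⟩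
      · have hbig := (hu₂.blow p hp).eventually_gt_atTop (M / η - (1 / 2 - m))
        filter_upwards [nhdsWithin_mono p inter_subset_left hbig, self_mem_nhdsWithin] with z h1 hz
        have h2 := hbound z ⟨hz.1, mem_ball_zero_iff.2 ((hle z hz).trans_lt hδδ₁)⟩
        have h3 : 0 ≤ C * (‖z - 0‖ ^ 2) ^ b := by positivity
        have h4 : M / η < u₂ z + (1 / 2 - m) := by linarith
        rw [div_lt_iff₀ hη] at h4
        linarith
      · rw [sub_zero] at hpr
        refine nhdsWithin_le_nhds ((hregF p hp hpr.le).continuousAt.eventually (gt_mem_nhds ?_))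
        have h1 := hbound p ⟨hp, mem_ball_zero_iff.2 (hpr.trans_lt hδδ₁)⟩
        have h2 : C * (‖p - 0‖ ^ 2) ^ b = M := by
          rw [sub_zero, hpr, hC]
          exact div_mul_cancel₀ _ (by positivity)
        have h3 := mul_pos hη (one_half_pos.trans_le (hH p hp))
        linarith
  intro z hz
  have hlim : Tendsto (fun η : ℝ => C * (‖z - 0‖ ^ 2) ^ b + η * (u₂ z + (1 / 2 - m))) (𝓝[>] 0)
      (𝓝 (C * (‖z - 0‖ ^ 2) ^ b)) := by
    have : Continuous fun η : ℝ => C * (‖z - 0‖ ^ 2) ^ b + η * (u₂ z + (1 / 2 - m)) := by fun_prop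
    simpa using (this.tendsto 0).mono_left nhdsWithin_le_nhds
  have hfin : u₁ z - u₂ z ≤ C * (‖z - 0‖ ^ 2) ^ b := by
    refine ge_of_tendsto hlim ?_
    filter_upwards [self_mem_nhdsWithin] with η hη
    linarith [hmain η hη z hz]
  have hpow : (‖z - 0‖ ^ 2) ^ b = ‖z‖ ^ (1 / μ) := by
    rw [sub_zero, ← Real.rpow_natCast_mul (norm_nonneg z), hb]
    congr 1
    push_cast
    field_simp
  rwa [hpow] at hfin

theorem blowUpSolution_of_contDiffOn {Ω : Set ℂ} {u : ℂ → ℝ} (hΩ : IsOpen Ω)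
    (hbdd : Bornology.IsBounded Ω) (hreg : ContDiffOn ℝ (⊤ : ℕ∞) u Ω)
    (heq : ∀ z ∈ Ω, lap u z = Real.exp (2 * u z))
    (hblow : ∀ p ∈ frontier Ω, Tendsto u (𝓝[Ω] p) atTop) : BlowUpSolution Ω u where
  isOpen := hΩ
  bounded := hbdd
  contDiffAt _ hz := (hreg.contDiffAt (hΩ.mem_nhds hz)).of_le
    (WithTop.coe_le_coe.2 (le_top : (2 : ℕ∞) ≤ ⊤))
  lap_eq := heq
  blow := hblow

/-- Lemma 5.3: boundary expansions near corner points are local: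
two blow-up solutions in domains coinciding near the origin, with a common `C²`
corner of angle `μπ` there, differ by `O(|z|^{1/μ})`. -/
theorem liouville_localization (μ : ℝ) (hμ0 : 0 < μ) (hμ2 : μ < 2)
    (Ω₁ Ω₂ : Set ℂ)
    (hΩ₁open : IsOpen Ω₁) (hΩ₁conn : IsConnected Ω₁) (hΩ₁bdd : Bornology.IsBounded Ω₁)
    (hΩ₂open : IsOpen Ω₂) (hΩ₂conn : IsConnected Ω₂) (hΩ₂bdd : Bornology.IsBounded Ω₂)
    (h₁ θ₁ : ℝ) (hh₁ : 0 < h₁) (hθ₁ : 0 < θ₁) (hθ₁' : θ₁ < Real.pi / 2)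
    (hcone₁ : UnifExtCone Ω₁ h₁ θ₁)
    (h₂ θ₂ : ℝ) (hh₂ : 0 < h₂) (hθ₂ : 0 < θ₂) (hθ₂' : θ₂ < Real.pi / 2)
    (hcone₂ : UnifExtCone Ω₂ h₂ θ₂)
    (h0₁ : (0 : ℂ) ∈ frontier Ω₁) (h0₂ : (0 : ℂ) ∈ frontier Ω₂)
    (ρ : ℝ) (hρ : 0 < ρ) (hcoin : Ω₁ ∩ Metric.ball 0 ρ = Ω₂ ∩ Metric.ball 0 ρ)
    (γ₁ γ₂ : ℝ → ℂ) (b₁ b₂ : ℝ) (hcorner : CornerAt Ω₁ μ γ₁ γ₂ b₁ b₂)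
    (u₁ u₂ : ℂ → ℝ)
    (h₁reg : ContDiffOn ℝ (⊤ : ℕ∞) u₁ Ω₁) (h₂reg : ContDiffOn ℝ (⊤ : ℕ∞) u₂ Ω₂)
    (h₁eq : ∀ z ∈ Ω₁, lap u₁ z = Real.exp (2 * u₁ z))
    (h₂eq : ∀ z ∈ Ω₂, lap u₂ z = Real.exp (2 * u₂ z))
    (h₁blow : ∀ p ∈ frontier Ω₁, Filter.Tendsto u₁ (nhdsWithin p Ω₁) Filter.atTop)
    (h₂blow : ∀ p ∈ frontier Ω₂, Filter.Tendsto u₂ (nhdsWithin p Ω₂) Filter.atTop) :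
    ∃ C δ : ℝ, 0 < C ∧ 0 < δ ∧ δ ≤ ρ ∧ ∀ z ∈ Ω₁ ∩ Metric.ball 0 δ,
      |u₁ z - u₂ z| ≤ C * ‖z‖ ^ (1 / μ) := by
  have hu₁ := blowUpSolution_of_contDiffOn hΩ₁open hΩ₁bdd h₁reg h₁eq h₁blow
  have hu₂ := blowUpSolution_of_contDiffOn hΩ₂open hΩ₂bdd h₂reg h₂eq h₂blow
  have hsec₁ : ∀ ε : ℝ, 0 < ε → ∃ r₀ : ℝ, 0 < r₀ ∧ ∃ r₁ : ℝ,
      Ω₁ ∩ ball 0 r₀ ⊆ sector (-ε) (μ * Real.pi + ε) r₁ := fun ε hε => by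
    obtain ⟨r₀, hr₀, -, hsub⟩ := hcorner.tangentCone ε hε
    exact ⟨r₀, hr₀, r₀, hsub⟩
  have hsec₂ : ∀ ε : ℝ, 0 < ε → ∃ r₀ : ℝ, 0 < r₀ ∧ ∃ r₁ : ℝ,
      Ω₂ ∩ ball 0 r₀ ⊆ sector (-ε) (μ * Real.pi + ε) r₁ := fun ε hε => by
    obtain ⟨r₀, hr₀, r₁, hsub⟩ := hsec₁ ε hε
    refine ⟨min r₀ ρ, lt_min hr₀ hρ, r₁, fun z hz => hsub ?_⟩
    exact ⟨(hcoin.symm.subset ⟨hz.1, ball_subset_ball (min_le_right _ _) hz.2⟩).1,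
      ball_subset_ball (min_le_left _ _) hz.2⟩
  obtain ⟨C, δ, hC, hδ, hle⟩ :=
    hu₁.exists_sub_le_rpow hu₂ hh₂ hθ₂ hθ₂' hcone₂ h0₂ hρ hcoin hμ0 hμ2 hsec₂
  obtain ⟨C', δ', hC', hδ', hle'⟩ :=
    hu₂.exists_sub_le_rpow hu₁ hh₁ hθ₁ hθ₁' hcone₁ h0₁ hρ hcoin.symm hμ0 hμ2 hsec₁
  refine ⟨max C C', min ρ (min δ δ'), by positivity, by positivity, min_le_left _ _, ?_⟩
  rintro z ⟨hz, hzδ⟩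
  rw [mem_ball_zero_iff, lt_min_iff, lt_min_iff] at hzδ
  have hz₂ : z ∈ Ω₂ := (hcoin.subset ⟨hz, mem_ball_zero_iff.2 hzδ.1⟩).1
  have h1 := hle z ⟨hz₂, mem_ball_zero_iff.2 hzδ.2.1⟩
  have h2 := hle' z ⟨hz, mem_ball_zero_iff.2 hzδ.2.2⟩
  have hpow : 0 ≤ ‖z‖ ^ (1 / μ) := by positivity
  have h3 := mul_le_mul_of_nonneg_right (le_max_left C C') hpow
  have h4 := mul_le_mul_of_nonneg_right (le_max_right C C') hpow
  exact abs_le.2 ⟨by linarith, by linarith⟩
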